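/- arXiv:math/0602194 — 2 statements merged into one kernel-verified Lean document; each statement's English description precedes it below -/
import Mathlib

section
/- Let A be a unital C*-algebra and a, b, c, d ∈ A. The matrix [[a, b], [c, d]] is a positive element of Mat₂(A) if and only if a ≥ 0, d ≥ 0, c = b*, and for every real ε > 0 one has d ≥ b* (a + ε·1)⁻¹ b (here a + ε·1 is invertible since a ≥ 0 and ε > 0). -/
open Matrix

/-- An element of `Mat₂(A)` is positive (as an element of the C*-algebra `Mat₂(A)`)
iff it is of the form `Nᴴ * N`. -/
def Mat2IsPositive {A : Type*} [Ring A] [StarRing A]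
    (M : Matrix (Fin 2) (Fin 2) A) : Prop :=
  ∃ N : Matrix (Fin 2) (Fin 2) A, M = Nᴴ * N

/-- If `a` is nonnegative and `ε > 0`, then `a + ε` is a unit. -/
lemma isUnit_add_smul_one_of_nonneg {A : Type*} [CStarAlgebra A] [PartialOrder A]
    [StarOrderedRing A] {a : A} (ha : 0 ≤ a) {ε : ℝ} (hε : 0 < ε) :
    IsUnit (a + (ε : ℂ) • (1 : A)) := by
  have h : algebraMap ℝ A ε = (ε : ℂ) • (1 : A) := by
    rw [Algebra.algebraMap_eq_smul_one, Complex.coe_smul]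
  refine CStarAlgebra.isUnit_of_le (algebraMap ℝ A ε) ?_
    (h := (IsStrictlyPositive.iff_of_unital.mpr ⟨algebraMap_nonneg A hε.le,
      (IsUnit.mk0 ε hε.ne').map (algebraMap ℝ A)⟩))
  rw [h]
  exact le_add_of_nonneg_left ha

/-- Nonnegative elements of a C⋆-algebra are of the form `star y * y`. Only C⋆-algebra instances
are required, so that this applies to `CStarMatrix`, whose topology is a product topology. -/
lemma exists_eq_star_mul_self_of_nonneg {B : Type*} [CStarAlgebra B] [PartialOrder B]
    [StarOrderedRing B] {x : B} (hx : 0 ≤ x) : ∃ y, x = star y * y :=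
  CStarAlgebra.nonneg_iff_eq_star_mul_self.mp hx

/-- Positivity of a `2 × 2` matrix may be tested on perturbations of its upper left entry. -/
lemma mat2IsPositive_of_forall_add_smul {A : Type*} [CStarAlgebra A] [PartialOrder A]
    [StarOrderedRing A] {a b c d : A}
    (h : ∀ ε : ℝ, 0 < ε → Mat2IsPositive !![a + (ε : ℂ) • (1 : A), b; c, d]) :
    Mat2IsPositive !![a, b; c, d] := by
  let F : ℝ → CStarMatrix (Fin 2) (Fin 2) A :=
    fun ε ↦ CStarMatrix.ofMatrix !![a + (ε : ℂ) • (1 : A), b; c, d]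
  have hcont : Continuous F := by
    have : Continuous fun ε : ℝ ↦ !![a + (ε : ℂ) • (1 : A), b; c, d] := by
      refine continuous_matrix fun i j ↦ ?_
      fin_cases i <;> fin_cases j <;> simp <;> fun_prop
    exact this
  have hpos : ∀ ε : ℝ, 0 < ε → 0 ≤ F ε := fun ε hε ↦ by
    obtain ⟨N, hN⟩ := h ε hε
    have : F ε = star (CStarMatrix.ofMatrix N) * CStarMatrix.ofMatrix N := hN
    rw [this]
    exact star_mul_self_nonneg _
  have h0 : 0 ≤ F 0 := by
    have hlim : Filter.Tendsto F (nhdsWithin 0 (Set.Ioi 0)) (nhds (F 0)) :=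
      hcont.continuousAt.tendsto.mono_left nhdsWithin_le_nhds
    exact ge_of_tendsto hlim (eventually_mem_nhdsWithin.mono hpos)
  obtain ⟨N, hN⟩ := exists_eq_star_mul_self_of_nonneg h0
  refine ⟨CStarMatrix.ofMatrix.symm N, ?_⟩
  have hF : F 0 = CStarMatrix.ofMatrix !![a, b; c, d] := by simp [F]
  rw [hF] at hN
  exact hN

/-- A `2 × 2` matrix with invertible upper left entry and nonnegative Schur complement is
positive. -/
lemma mat2IsPositive_of_schur {A : Type*} [CStarAlgebra A] [PartialOrder A]
    [StarOrderedRing A] {e b d : A} (he : 0 ≤ e) (hu : IsUnit e)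
    (hs : star b * Ring.inverse e * b ≤ d) : Mat2IsPositive !![e, b; star b, d] := by
  obtain ⟨x, hx⟩ := CStarAlgebra.nonneg_iff_eq_star_mul_self.mp he
  obtain ⟨y, hy⟩ := CStarAlgebra.nonneg_iff_eq_star_mul_self.mp (sub_nonneg.mpr hs)
  have hf : star (Ring.inverse e) = Ring.inverse e := by
    rw [← Ring.inverse_star, (IsSelfAdjoint.of_nonneg he).star_eq]
  have hef := Ring.mul_inverse_cancel e hu
  have hfe := Ring.inverse_mul_cancel e hu
  generalize Ring.inverse e = f at *
  refine ⟨!![x, x * (f * b); 0, y], ?_⟩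
  ext i j
  fin_cases i <;> fin_cases j <;> simp [Matrix.mul_apply, Fin.sum_univ_two, hf]
  · exact hx
  · rw [← mul_assoc, ← hx, ← mul_assoc, hef, one_mul]
  · rw [mul_assoc, mul_assoc, ← hx, hfe, mul_one]
  · rw [← hy]
    have : star b * f * star x * (x * (f * b)) = star b * f * b := by
      calc _ = star b * f * ((star x * x) * f) * b := by noncomm_ring
        _ = _ := by rw [← hx, hef, mul_one]
    rw [this]
    abel

theorem stmt_1 {A : Type*} [CStarAlgebra A] [PartialOrder A] [StarOrderedRing A]
    (a b c d : A) :
    Mat2IsPositive !![a, b; c, d] ↔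
      0 ≤ a ∧ 0 ≤ d ∧ c = star b ∧
        ∀ ε : ℝ, 0 < ε → star b * Ring.inverse (a + (ε : ℂ) • 1) * b ≤ d := by
  constructor
  · rintro ⟨N, hN⟩
    have ha : a = star (N 0 0) * N 0 0 + star (N 1 0) * N 1 0 := by
      simpa [Matrix.mul_apply, Fin.sum_univ_two] using congrFun₂ hN 0 0
    have hb : b = star (N 0 0) * N 0 1 + star (N 1 0) * N 1 1 := by
      simpa [Matrix.mul_apply, Fin.sum_univ_two] using congrFun₂ hN 0 1
    have hc : c = star (N 0 1) * N 0 0 + star (N 1 1) * N 1 0 := by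
      simpa [Matrix.mul_apply, Fin.sum_univ_two] using congrFun₂ hN 1 0
    have hd : d = star (N 0 1) * N 0 1 + star (N 1 1) * N 1 1 := by
      simpa [Matrix.mul_apply, Fin.sum_univ_two] using congrFun₂ hN 1 1
    have ha0 : 0 ≤ a := ha ▸ add_nonneg (star_mul_self_nonneg _) (star_mul_self_nonneg _)
    refine ⟨ha0, hd ▸ add_nonneg (star_mul_self_nonneg _) (star_mul_self_nonneg _),
      by simp [hb, hc], fun ε hε ↦ ?_⟩
    have hu := isUnit_add_smul_one_of_nonneg ha0 hε
    set w := Ring.inverse (a + (ε : ℂ) • (1 : A)) * b with hw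
    have hew : a * w + ε • w = b := by
      have := Ring.mul_inverse_cancel_left _ b hu
      rwa [← hw, add_mul, smul_mul_assoc, one_mul, Complex.coe_smul] at this
    have key : d - star b * w = star (N 0 1 - N 0 0 * w) * (N 0 1 - N 0 0 * w) +
        star (N 1 1 - N 1 0 * w) * (N 1 1 - N 1 0 * w) + ε • (star w * w) := by
      have h1 : star w * (a * w) + ε • (star w * w) = star w * b := by
        rw [← mul_smul_comm, ← mul_add, hew]
      have hsb : star b = star (N 0 1) * N 0 0 + star (N 1 1) * N 1 0 := by simp [hb]
      have h2 : ε • (star w * w) = star w * b - star w * (a * w) := by rw [← h1]; abel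
      rw [h2, hsb, ha, hb, hd]
      simp only [star_sub, star_mul]
      noncomm_ring
    rw [mul_assoc, ← hw, ← sub_nonneg, key]
    exact add_nonneg (add_nonneg (star_mul_self_nonneg _) (star_mul_self_nonneg _))
      (smul_nonneg hε.le (star_mul_self_nonneg _))
  · rintro ⟨ha, -, rfl, h⟩
    refine mat2IsPositive_of_forall_add_smul fun ε hε ↦
      mat2IsPositive_of_schur ?_ (isUnit_add_smul_one_of_nonneg ha hε) (h ε hε)
    rw [Complex.coe_smul]
    exact add_nonneg ha (smul_nonneg hε.le zero_le_one)
end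

section
/- Let A be a unital C*-algebra and a, b, d ∈ A. Assume that a commutes with b and that b commutes with d. If the matrix [[a, b], [b*, d]] is a positive element of Mat₂(A), then the matrix [[a, b*], [b, d]] is also a positive element of Mat₂(A). -/
open Matrix

section CStarAlgebra

variable {A : Type*} [CStarAlgebra A]

lemma CStarAlgebra.exists_eq_star_mul_self_iff_nonneg [PartialOrder A] [StarOrderedRing A]
    (a : A) : (∃ b, a = star b * b) ↔ 0 ≤ a :=
  CStarAlgebra.nonneg_iff_eq_star_mul_self.symm

lemma mat2IsPositive_iff_nonneg [PartialOrder A] [StarOrderedRing A]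
    (M : Matrix (Fin 2) (Fin 2) A) :
    Mat2IsPositive M ↔ 0 ≤ CStarMatrix.ofMatrix M :=
  CStarAlgebra.exists_eq_star_mul_self_iff_nonneg (CStarMatrix.ofMatrix M)

lemma mat2IsPositive_iff_exists (a b c d : A) :
    Mat2IsPositive !![a, b; c, d] ↔ ∃ x y z w : A,
      a = star x * x + star z * z ∧ b = star x * y + star z * w ∧
      c = star y * x + star w * z ∧ d = star y * y + star w * w := by
  have key (N : Matrix (Fin 2) (Fin 2) A) : !![a, b; c, d] = Nᴴ * N ↔
      a = star (N 0 0) * N 0 0 + star (N 1 0) * N 1 0 ∧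
      b = star (N 0 0) * N 0 1 + star (N 1 0) * N 1 1 ∧
      c = star (N 0 1) * N 0 0 + star (N 1 1) * N 1 0 ∧
      d = star (N 0 1) * N 0 1 + star (N 1 1) * N 1 1 := by
    simp [← Matrix.ext_iff, Fin.forall_fin_two, Matrix.mul_apply, Fin.sum_univ_two, and_assoc]
  constructor
  · rintro ⟨N, hN⟩
    exact ⟨_, _, _, _, (key N).1 hN⟩
  · rintro ⟨x, y, z, w, h⟩
    exact ⟨!![x, y; z, w], (key _).2 (by simpa using h)⟩

variable [PartialOrder A] [StarOrderedRing A]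

lemma Mat2IsPositive.nonneg_left {a b c d : A} (h : Mat2IsPositive !![a, b; c, d]) : 0 ≤ a := by
  obtain ⟨x, y, z, w, rfl, -⟩ := (mat2IsPositive_iff_exists ..).1 h
  exact add_nonneg (star_mul_self_nonneg x) (star_mul_self_nonneg z)

lemma Mat2IsPositive.nonneg_right {a b c d : A} (h : Mat2IsPositive !![a, b; c, d]) : 0 ≤ d := by
  obtain ⟨x, y, z, w, -, -, -, rfl⟩ := (mat2IsPositive_iff_exists ..).1 h
  exact add_nonneg (star_mul_self_nonneg y) (star_mul_self_nonneg w)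

/-- A Schur complement criterion, where `r` and `s` play the role of `a ^ (1 / 2)` and
`a ^ (-1 / 2)`. -/
lemma mat2IsPositive_iff_schur {a b d r s : A} (hr : IsSelfAdjoint r) (hs : IsSelfAdjoint s)
    (hra : r * r = a) (hrs : r * s = 1) (hsr : s * r = 1) :
    Mat2IsPositive !![a, b; star b, d] ↔ star b * (s * s) * b ≤ d := by
  rw [mat2IsPositive_iff_exists]
  constructor
  · rintro ⟨x, y, z, w, hx, hb, hb', hd⟩
    rw [← sub_nonneg]
    have hss : s * s * a * (s * s) = s * s := by
      calc s * s * a * (s * s) = s * (s * r) * (r * s) * s := by rw [← hra]; noncomm_ring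
        _ = s * s := by rw [hsr, hrs]; noncomm_ring
    have key : d - star b * (s * s) * b =
        star (y - x * (s * s * b)) * (y - x * (s * s * b)) +
          star (w - z * (s * s * b)) * (w - z * (s * s * b)) := by
      simp only [star_sub, star_mul, hs.star_eq]
      calc d - star b * (s * s) * b
          = d - star b * (s * s) * b - star b * (s * s) * b
            + star b * (s * s * a * (s * s)) * b := by rw [hss]; noncomm_ring
        _ = (star y * y + star w * w) - (star y * x + star w * z) * (s * s) * b
            - star b * (s * s) * (star x * y + star z * w)
            + star b * (s * s * (star x * x + star z * z) * (s * s)) * b := by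
          rw [← hx, ← hb, ← hb', ← hd]
        _ = _ := by noncomm_ring
    rw [key]
    exact add_nonneg (star_mul_self_nonneg _) (star_mul_self_nonneg _)
  · intro h
    obtain ⟨w, hw⟩ := CStarAlgebra.nonneg_iff_eq_star_mul_self.1 (sub_nonneg.2 h)
    refine ⟨r, s * b, 0, w, ?_, ?_, ?_, ?_⟩
    · simp [hr.star_eq, hra]
    · simp [hr.star_eq, ← mul_assoc, hrs]
    · simp [hs.star_eq, mul_assoc, hsr]
    · rw [← hw]
      simp only [star_mul, hs.star_eq]
      noncomm_ring

lemma IsStrictlyPositive.exists_sqrt_inverse {a : A} (ha : IsStrictlyPositive a) :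
    ∃ r s : A, IsSelfAdjoint r ∧ IsSelfAdjoint s ∧ r * r = a ∧ r * s = 1 ∧ s * r = 1 ∧
      ∀ b, Commute a b → Commute s b := by
  obtain ⟨u, hu⟩ := ha.isUnit_cfcSqrt
  have hur : IsSelfAdjoint (u : A) := hu ▸ (CFC.sqrt_nonneg a).isSelfAdjoint
  refine ⟨u, ↑u⁻¹, hur, ?_, ?_, u.mul_inv, u.inv_mul, fun b hb ↦ ?_⟩
  · have : star u = u := Units.ext hur.star_eq
    rw [IsSelfAdjoint, ← Units.coe_star, star_inv, this]
  · rw [hu, CFC.sqrt_mul_sqrt_self a ha.nonneg]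
  · have : Commute (u : A) b := by
      rw [hu, CFC.sqrt_eq_cfc]
      exact hb.cfc_nnreal _
    exact this.units_inv_left

lemma mul_star_self_le_one_of_star_mul_self_le_one {x : A} (h : star x * x ≤ 1) :
    x * star x ≤ 1 := by
  rw [← CStarAlgebra.norm_le_one_iff_of_nonneg _ (mul_star_self_nonneg x),
    CStarRing.norm_self_mul_star, ← CStarRing.norm_star_mul_self]
  exact (CStarAlgebra.norm_le_one_iff_of_nonneg _ (star_mul_self_nonneg x)).2 h

lemma IsStrictlyPositive.mul_star_self_le_of_commute {b c : A} (hc : IsStrictlyPositive c)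
    (hcb : Commute c b) (h : star b * b ≤ c) : b * star b ≤ c := by
  obtain ⟨r, s, hr, hs, rfl, hrs, hsr, hcomm⟩ := hc.exists_sqrt_inverse
  have hsb : s * b = b * s := hcomm b hcb
  have h₁ : star (b * s) * (b * s) ≤ 1 := by
    have := star_left_conjugate_le_conjugate h s
    rw [hs.star_eq] at this
    calc star (b * s) * (b * s) = s * (star b * b) * s := by
          rw [star_mul, hs.star_eq]; noncomm_ring
      _ ≤ s * (r * r) * s := this
      _ = (s * r) * (r * s) := by noncomm_ring
      _ = 1 := by rw [hsr, hrs, one_mul]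
  have h₂ := star_left_conjugate_le_conjugate
    (mul_star_self_le_one_of_star_mul_self_le_one h₁) r
  rw [← hsb, star_mul, hs.star_eq, hr.star_eq] at h₂
  calc b * star b = (r * s) * b * star b * (s * r) := by rw [hrs, hsr]; noncomm_ring
    _ = r * (s * b * (star b * s)) * r := by noncomm_ring
    _ ≤ r * 1 * r := h₂
    _ = r * r := by rw [mul_one]

lemma Mat2IsPositive.swap_of_isStrictlyPositive {a b d : A} (ha : IsStrictlyPositive a)
    (hd : IsStrictlyPositive d) (hab : Commute a b) (hbd : Commute b d)
    (h : Mat2IsPositive !![a, b; star b, d]) : Mat2IsPositive !![a, star b; b, d] := by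
  obtain ⟨r, s, hr, hs, hra, hrs, hsr, hcomm⟩ := ha.exists_sqrt_inverse
  have hsb : Commute s b := hcomm b hab
  have hsb' : Commute s (star b) := by simpa [hs.star_eq] using hsb.star_star
  have hrb : Commute r b := by
    let u : Aˣ := ⟨s, r, hsr, hrs⟩
    exact Commute.units_inv_left (u := u) hsb
  have hc : IsStrictlyPositive (r * d * r) :=
    hd.conjugate_of_isUnit_of_isSelfAdjoint d r ⟨⟨r, s, hrs, hsr⟩, rfl⟩ hr
  have hle : star b * b ≤ r * d * r := by
    have := star_left_conjugate_le_conjugate ((mat2IsPositive_iff_schur hr hs hra hrs hsr).1 h) r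
    rw [hr.star_eq] at this
    convert this using 1
    calc star b * b = (r * s) * star b * b * (s * r) := by rw [hrs, hsr]; noncomm_ring
      _ = r * (s * star b) * (b * s) * r := by noncomm_ring
      _ = r * (star b * (s * s) * b) * r := by rw [hsb'.eq, ← hsb.eq]; noncomm_ring
  have hle' := star_left_conjugate_le_conjugate
    (hc.mul_star_self_le_of_commute ((hrb.mul_left hbd.symm).mul_left hrb) hle) s
  have : Mat2IsPositive !![a, star b; star (star b), d] := by
    rw [mat2IsPositive_iff_schur hr hs hra hrs hsr, star_star]
    calc b * (s * s) * star b = (b * s) * (s * star b) := by noncomm_ring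
      _ = star s * (b * star b) * s := by
        rw [← hsb.eq, hsb'.eq, hs.star_eq]; noncomm_ring
      _ ≤ star s * (r * d * r) * s := hle'
      _ = (s * r) * d * (r * s) := by rw [hs.star_eq]; noncomm_ring
      _ = d := by rw [hsr, hrs, one_mul, mul_one]
  rwa [star_star] at this

lemma Mat2IsPositive.add_smul_one {a b c d : A} (h : Mat2IsPositive !![a, b; c, d]) {ε : ℝ}
    (hε : 0 ≤ ε) : Mat2IsPositive !![a + ε • 1, b; c, d + ε • 1] := by
  obtain ⟨e, he⟩ := CStarAlgebra.nonneg_iff_eq_star_mul_self.1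
    (smul_nonneg hε (zero_le_one (α := A)))
  have h₁ : Mat2IsPositive !![ε • (1 : A), 0; 0, ε • 1] :=
    (mat2IsPositive_iff_exists ..).2 ⟨e, 0, 0, e, by simp [he]⟩
  rw [mat2IsPositive_iff_nonneg] at h h₁ ⊢
  convert add_nonneg h h₁ using 1
  simp

lemma mat2IsPositive_of_forall_pos_add_smul_one {a b c d : A}
    (h : ∀ ε : ℝ, 0 < ε → Mat2IsPositive !![a + ε • 1, b; c, d + ε • 1]) :
    Mat2IsPositive !![a, b; c, d] := by
  simp only [mat2IsPositive_iff_nonneg] at h ⊢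
  let f : ℝ → CStarMatrix (Fin 2) (Fin 2) A :=
    fun ε ↦ CStarMatrix.ofMatrixL !![a + ε • 1, b; c, d + ε • 1]
  have hf : Continuous f := by
    refine CStarMatrix.ofMatrixL.continuous.comp (continuous_matrix fun i j ↦ ?_)
    fin_cases i <;> fin_cases j <;> simp <;> fun_prop
  have hlim : Filter.Tendsto f (nhdsWithin 0 (Set.Ioi 0))
      (nhds (CStarMatrix.ofMatrix !![a, b; c, d])) := by
    have := (hf.tendsto 0).mono_left (nhdsWithin_le_nhds (s := Set.Ioi 0))
    simpa [f, CStarMatrix.ofMatrix_eq_ofMatrixL] using this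
  exact CStarAlgebra.isClosed_nonneg.mem_of_tendsto hlim
    (Filter.eventually_of_mem self_mem_nhdsWithin fun ε hε ↦ h ε hε)

end CStarAlgebra

theorem stmt_7 {A : Type*} [CStarAlgebra A] (a b d : A)
    (hab : a * b = b * a) (hbd : b * d = d * b)
    (h : Mat2IsPositive !![a, b; star b, d]) :
    Mat2IsPositive !![a, star b; b, d] := by
  let _ := CStarAlgebra.spectralOrder A
  let _ := CStarAlgebra.spectralOrderedRing A
  refine mat2IsPositive_of_forall_pos_add_smul_one fun ε hε ↦ ?_
  have hε₁ : IsStrictlyPositive (ε • (1 : A)) := isStrictlyPositive_one.smul hε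
  exact (h.add_smul_one hε.le).swap_of_isStrictlyPositive
    (hε₁.nonneg_add h.nonneg_left) (hε₁.nonneg_add h.nonneg_right)
    (Commute.add_left hab ((Commute.one_left b).smul_left ε))
    (Commute.add_right hbd ((Commute.one_right b).smul_right ε))
end
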